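/- For the training loss f of a deep linear network, assume the network is deep (n ≥ 3) and that the zero mapping is not a global minimizer of the training loss, i.e. ∇φ(0) ≠ 0. Then inf_{θ∈ℝ^d} λ_min(∇²f(θ)) = −∞. -/

import Mathlib

open scoped RealInnerProductSpace
open Matrix

noncomputable section

/-- The family of weight matrices of a depth-`n` fully connected network with layer widths
`dims 0, dims 1, …, dims n`: `W j` maps `ℝ^{dims j}` to `ℝ^{dims (j+1)}` (zero-indexed). -/
abbrev WeightFam (n : ℕ) (dims : ℕ → ℕ) : Type :=
  ∀ j : Fin n, Matrix (Fin (dims (j.val + 1))) (Fin (dims j.val)) ℝ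

/-- Rectangular matrix with ones on the diagonal: equals the identity matrix whenever the
two dimensions coincide. -/
def castId (p q : ℕ) : Matrix (Fin p) (Fin q) ℝ :=
  Matrix.of fun i j => if (i : ℕ) = (j : ℕ) then 1 else 0

/-- `segProd dims W a b = W_{b-1} * ⋯ * W_a` (zero-indexed), the identity when `a = b`.
This realizes the paper's product `W_{b : a+1}` (one-indexed), empty products being
identity matrices. -/
def segProd {n : ℕ} (dims : ℕ → ℕ) (W : WeightFam n dims) (a : ℕ) :
    (b : ℕ) → Matrix (Fin (dims b)) (Fin (dims a)) ℝ
  | 0 => castId (dims 0) (dims a)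
  | b + 1 =>
      if a = b + 1 then castId (dims (b + 1)) (dims a)
      else if hb : b < n then W ⟨b, hb⟩ * segProd dims W a b else 0

/-- Multiplication of a Euclidean vector by a matrix. -/
def mulVecE {p q : ℕ} (M : Matrix (Fin p) (Fin q) ℝ) (v : EuclideanSpace ℝ (Fin q)) :
    EuclideanSpace ℝ (Fin p) :=
  (EuclideanSpace.equiv (Fin p) ℝ).symm (M.mulVec (EuclideanSpace.equiv (Fin q) ℝ v))

/-- The space of `p × q` real matrices regarded as a Euclidean space (so that the Euclidean
norm is the Frobenius norm). -/
abbrev MatE (p q : ℕ) : Type := EuclideanSpace ℝ (Fin p × Fin q)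

/-- Conversion from the Euclidean representation to the matrix itself. -/
def toMat {p q : ℕ} (w : MatE p q) : Matrix (Fin p) (Fin q) ℝ :=
  Matrix.of fun i j => w (i, j)

/-- Conversion from a matrix to its Euclidean representation. -/
def ofMat {p q : ℕ} (M : Matrix (Fin p) (Fin q) ℝ) : MatE p q :=
  (EuclideanSpace.equiv (Fin p × Fin q) ℝ).symm fun ij => M ij.1 ij.2

/-- The Hessian of `f` at `x`, regarded as a quadratic form, evaluated at `v`. -/
def hessQ {E : Type*} [NormedAddCommGroup E] [InnerProductSpace ℝ E] [CompleteSpace E]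
    (f : E → ℝ) (x v : E) : ℝ :=
  ⟪v, fderiv ℝ (gradient f) x v⟫

/-- `φ(W) = (1/|S|) ∑ᵢ ℓ(W xᵢ, yᵢ)`, as a function of the Euclidean representation of the
matrix `W`. -/
def phiE {Y : Type*} {s : ℕ} (n : ℕ) (dims : ℕ → ℕ)
    (loss : EuclideanSpace ℝ (Fin (dims n)) → Y → ℝ)
    (x : Fin s → EuclideanSpace ℝ (Fin (dims 0))) (y : Fin s → Y)
    (w : MatE (dims n) (dims 0)) : ℝ :=
  (1 / (s : ℝ)) * ∑ i, loss (mulVecE (toMat w) (x i)) (y i)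

/-- The training loss of the deep linear network: `f θ = φ (W_{n:1})`. -/
def linLoss {Y : Type*} {s : ℕ} {n d : ℕ} (dims : ℕ → ℕ)
    (loss : EuclideanSpace ℝ (Fin (dims n)) → Y → ℝ)
    (x : Fin s → EuclideanSpace ℝ (Fin (dims 0))) (y : Fin s → Y)
    (arr : EuclideanSpace ℝ (Fin d) →ₗ[ℝ] WeightFam n dims)
    (θ : EuclideanSpace ℝ (Fin d)) : ℝ :=
  phiE n dims loss x y (ofMat (segProd dims (arr θ) 0 n))

theorem contDiff_gradient {E : Type*} [NormedAddCommGroup E] [InnerProductSpace ℝ E]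
    [CompleteSpace E] {f : E → ℝ} (hf : ContDiff ℝ 2 f) : ContDiff ℝ 1 (gradient f) :=
  (InnerProductSpace.toDual ℝ E).symm.contDiff.comp
    (hf.fderiv_right (m := 1) (by norm_num))

/-- The Hessian quadratic form is the second derivative along the line `x + t • v`. -/
theorem hessQ_eq_of_hasDerivAt {E : Type*} [NormedAddCommGroup E] [InnerProductSpace ℝ E]
    [CompleteSpace E] {f : E → ℝ} (hf : ContDiff ℝ 2 f) {x v : E} {g : ℝ → ℝ} {m : ℝ}
    (hg : ∀ t : ℝ, HasDerivAt (fun t : ℝ => f (x + t • v)) (g t) t)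
    (hm : HasDerivAt g m 0) : hessQ f x v = m := by
  have hline : ∀ t : ℝ, HasDerivAt (fun t : ℝ => x + t • v) v t := fun t => by
    simpa using ((hasDerivAt_id t).smul_const v).const_add x
  have hfd : Differentiable ℝ f := hf.differentiable (by norm_num)
  have hgrad : Differentiable ℝ (gradient f) :=
    (contDiff_gradient hf).differentiable (by norm_num)
  have hgt : g = fun t : ℝ => ⟪v, gradient f (x + t • v)⟫ := by
    funext t
    have h := (hfd (x + t • v)).hasFDerivAt.comp_hasDerivAt t (hline t)
    rw [(hg t).unique h, real_inner_comm, inner_gradient_left]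
  have hd : HasDerivAt (fun t : ℝ => gradient f (x + t • v)) (fderiv ℝ (gradient f) x v) 0 := by
    have h := (hgrad (x + (0 : ℝ) • v)).hasFDerivAt.comp_hasDerivAt (0 : ℝ) (hline 0)
    simpa [Function.comp_def] using h
  have hi := (hasDerivAt_const (0 : ℝ) v).inner ℝ hd
  rw [hgt] at hm
  simpa [hessQ] using hi.unique hm

/-- The Hessian along a line on which `f` coincides with `F` along the parabola
`(a / 2) * t ^ 2 • e` is determined by the first derivative of `F` at the origin. -/
theorem hessQ_of_quadratic_line {E F : Type*} [NormedAddCommGroup E] [InnerProductSpace ℝ E]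
    [CompleteSpace E] [NormedAddCommGroup F] [InnerProductSpace ℝ F] [CompleteSpace F]
    {f : E → ℝ} {φ : F → ℝ} (hf : ContDiff ℝ 2 f) (hφ : ContDiff ℝ 2 φ) {x v : E} {e : F} {a : ℝ}
    (h : ∀ t : ℝ, f (x + t • v) = φ ((a / 2 * t ^ 2) • e)) :
    hessQ f x v = a * ⟪gradient φ 0, e⟫ := by
  have hcurve : ∀ t : ℝ, HasDerivAt (fun t : ℝ => (a / 2 * t ^ 2) • e) ((t * a) • e) t := fun t => by
    have h2 := (((hasDerivAt_id t).pow 2).const_mul (a / 2)).smul_const e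
    refine h2.congr_deriv (congrArg (· • e) ?_)
    simp
    ring
  have hφd : Differentiable ℝ φ := hφ.differentiable (by norm_num)
  have hgrad : Differentiable ℝ (gradient φ) :=
    (contDiff_gradient hφ).differentiable (by norm_num)
  refine hessQ_eq_of_hasDerivAt hf
    (g := fun t : ℝ => t * (a * ⟪gradient φ ((a / 2 * t ^ 2) • e), e⟫)) (fun t => ?_) ?_
  · simp only [h]
    have h2 := (hφd ((a / 2 * t ^ 2) • e)).hasFDerivAt.comp_hasDerivAt t (hcurve t)
    refine h2.congr_deriv ?_
    rw [inner_gradient_left, map_smul, smul_eq_mul]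
    ring
  · have hd : DifferentiableAt ℝ
        (fun t : ℝ => a * ⟪gradient φ ((a / 2 * t ^ 2) • e), e⟫) 0 :=
      ((((hgrad _).comp (0 : ℝ) (hcurve 0).differentiableAt)).inner ℝ
        (differentiableAt_const e)).const_mul a
    simpa [Pi.mul_def] using (hasDerivAt_id (0 : ℝ)).mul hd.hasDerivAt

theorem contDiff_segProd_apply {E : Type*} [NormedAddCommGroup E] [NormedSpace ℝ E]
    [FiniteDimensional ℝ E] {n : ℕ} (dims : ℕ → ℕ) (arr : E →ₗ[ℝ] WeightFam n dims) (a b : ℕ)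
    (i : Fin (dims b)) (j : Fin (dims a)) {k : WithTop ℕ∞} :
    ContDiff ℝ k (fun θ : E => segProd dims (arr θ) a b i j) := by
  induction b with
  | zero => exact contDiff_const
  | succ b ih =>
    simp only [segProd]
    split_ifs with h1 h2
    · exact contDiff_const
    · simp only [Matrix.mul_apply]
      refine ContDiff.sum fun r _ => ContDiff.mul ?_ (ih r)
      exact (LinearMap.toContinuousLinearMap
        { toFun := fun θ : E => arr θ ⟨b, h2⟩ i r
          map_add' := fun u v => by simp
          map_smul' := fun c u => by simp }).contDiff
    · exact contDiff_const

theorem contDiff_phiE {Y : Type*} {s : ℕ} (n : ℕ) (dims : ℕ → ℕ)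
    {loss : EuclideanSpace ℝ (Fin (dims n)) → Y → ℝ} {k : WithTop ℕ∞}
    (hsm : ∀ yy : Y, ContDiff ℝ k (fun v => loss v yy))
    (x : Fin s → EuclideanSpace ℝ (Fin (dims 0))) (y : Fin s → Y) :
    ContDiff ℝ k (phiE n dims loss x y) := by
  refine contDiff_const.mul (ContDiff.sum fun i _ => (hsm (y i)).comp ?_)
  rw [contDiff_euclidean]
  intro r
  simp only [mulVecE, toMat, Matrix.mulVec, dotProduct, EuclideanSpace.equiv,
    PiLp.continuousLinearEquiv_symm_apply, Matrix.of_apply]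
  fun_prop

theorem contDiff_linLoss {Y : Type*} {s n d : ℕ} (dims : ℕ → ℕ)
    {loss : EuclideanSpace ℝ (Fin (dims n)) → Y → ℝ} {k : WithTop ℕ∞}
    (hsm : ∀ yy : Y, ContDiff ℝ k (fun v => loss v yy))
    (x : Fin s → EuclideanSpace ℝ (Fin (dims 0))) (y : Fin s → Y)
    (arr : EuclideanSpace ℝ (Fin d) →ₗ[ℝ] WeightFam n dims) :
    ContDiff ℝ k (linLoss dims loss x y arr) := by
  refine (contDiff_phiE n dims hsm x y).comp ?_
  rw [contDiff_euclidean]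
  exact fun ij => contDiff_segProd_apply dims arr 0 n ij.1 ij.2

/-- Weights whose `j`-th matrix has the single entry `γ j` in position `(κ (j + 1), κ j)`. -/
def singleFam {n : ℕ} (dims κ : ℕ → ℕ) (γ : ℕ → ℝ) : WeightFam n dims := fun j =>
  Matrix.of fun r c => if (r : ℕ) = κ (j + 1) ∧ (c : ℕ) = κ j then γ j else 0

theorem singleFam_add_smul {n : ℕ} (dims κ : ℕ → ℕ) (γ δ : ℕ → ℝ) (t : ℝ) :
    (singleFam dims κ γ + t • singleFam dims κ δ : WeightFam n dims) =
      singleFam dims κ (γ + t • δ) := by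
  ext j r c
  by_cases h : (r : ℕ) = κ (j + 1) ∧ (c : ℕ) = κ j <;> simp [singleFam, h]

theorem segProd_singleFam {n : ℕ} {dims κ : ℕ → ℕ} (hκ : ∀ j, κ j < dims j) (γ : ℕ → ℝ)
    {b : ℕ} (hb : b < n) (r : Fin (dims (b + 1))) (c : Fin (dims 0)) :
    segProd (n := n) dims (singleFam dims κ γ) 0 (b + 1) r c =
      if (r : ℕ) = κ (b + 1) ∧ (c : ℕ) = κ 0 then ∏ i ∈ Finset.range (b + 1), γ i else 0 := by
  induction b with
  | zero =>
    have hone : castId (dims 0) (dims 0) = 1 := by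
      ext i j
      simp [castId, Matrix.one_apply, Fin.ext_iff]
    simp [segProd, hb, hone, singleFam]
  | succ b ih =>
    rw [segProd, if_neg (by omega), dif_pos hb, Matrix.mul_apply]
    simp only [ih (by omega)]
    rw [Finset.sum_eq_single ⟨κ (b + 1), hκ _⟩]
    · rw [Finset.prod_range_succ _ (b + 1)]
      by_cases h1 : (r : ℕ) = κ (b + 1 + 1) <;> by_cases h2 : (c : ℕ) = κ 0 <;>
        simp [singleFam, h1, h2, mul_comm]
    · intro i _ hi
      have : (i : ℕ) ≠ κ (b + 1) := fun h => hi (Fin.ext h)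
      simp [singleFam, this]
    · simp

theorem sum_singleFam_mul_self {n : ℕ} {dims κ : ℕ → ℕ} (hκ : ∀ j, κ j < dims j) (γ : ℕ → ℝ) :
    ∑ j : Fin n, ∑ p : Fin (dims (j.val + 1)), ∑ q : Fin (dims j.val),
        singleFam (n := n) dims κ γ j p q * singleFam (n := n) dims κ γ j p q =
      ∑ j ∈ Finset.range n, γ j ^ 2 := by
  rw [← Fin.sum_univ_eq_sum_range (fun j => γ j ^ 2)]
  refine Finset.sum_congr rfl fun j _ => ?_
  rw [Finset.sum_eq_single ⟨κ (j + 1), hκ _⟩, Finset.sum_eq_single ⟨κ j, hκ _⟩]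
  · simp [singleFam, sq]
  · intro i _ hi
    have : (i : ℕ) ≠ κ j := fun h => hi (Fin.ext h)
    simp [singleFam, this]
  · simp
  · intro i _ hi
    have : (i : ℕ) ≠ κ (j + 1) := fun h => hi (Fin.ext h)
    simp [singleFam, this]
  · simp

/-- Proposition 1 of the paper: if the network is deep (`n ≥ 3`) and the
zero mapping is not a global minimizer of the training loss (`∇φ(0) ≠ 0`), then
`inf_θ λ_min(∇²f(θ)) = -∞`. -/
theorem deep_linear_hessian_min_eig_unbounded_below {n d : ℕ} (hn : 3 ≤ n)
    (dims : ℕ → ℕ) (hdims : ∀ j, 0 < dims j)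
    {Y : Type*} (s : ℕ) (hs : 0 < s)
    (x : Fin s → EuclideanSpace ℝ (Fin (dims 0))) (y : Fin s → Y)
    (loss : EuclideanSpace ℝ (Fin (dims n)) → Y → ℝ)
    (hconv : ∀ yy : Y, ConvexOn ℝ Set.univ (fun v => loss v yy))
    (hsm : ∀ yy : Y, ContDiff ℝ 2 (fun v => loss v yy))
    (arr : EuclideanSpace ℝ (Fin d) →ₗ[ℝ] WeightFam n dims)
    (harr : Function.Bijective arr)
    (hinner : ∀ u v : EuclideanSpace ℝ (Fin d), ⟪u, v⟫ =
      ∑ j : Fin n, ∑ p : Fin (dims (j.val + 1)), ∑ q : Fin (dims j.val),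
        arr u j p q * arr v j p q)
    (hgrad : gradient (phiE n dims loss x y) 0 ≠ 0) :
    ∀ c : ℝ, ∃ θ v : EuclideanSpace ℝ (Fin d), ‖v‖ = 1 ∧
      hessQ (linLoss dims loss x y arr) θ v < c := by
  intro c
  obtain ⟨m, rfl⟩ : ∃ m, n = m + 3 := ⟨n - 3, by omega⟩
  set φ := phiE (m + 3) dims loss x y
  obtain ⟨⟨p, q⟩, hpq⟩ : ∃ pq, gradient φ 0 pq ≠ 0 := by
    by_contra! h
    exact hgrad (PiLp.ext h)
  set a : ℝ := (c - 1) / gradient φ 0 (p, q) with ha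
  set κ : ℕ → ℕ := fun j => if j = 0 then q else if j = m + 3 then p else 0 with hκdef
  have hκ : ∀ j, κ j < dims j := by
    intro j
    simp only [hκdef]
    split_ifs with h1 h2
    · subst h1; exact q.isLt
    · subst h2; exact p.isLt
    · exact hdims j
  set γ : ℕ → ℝ := fun j => if j = 0 ∨ j = m + 2 then 0 else if j = 1 then a else 1 with hγ
  set δ : ℕ → ℝ := fun j => if j = 0 ∨ j = m + 2 then (√2)⁻¹ else 0 with hδ
  have hsqrt : (√2)⁻¹ * (√2)⁻¹ = (1 / 2 : ℝ) := by
    rw [← mul_inv, Real.mul_self_sqrt (by norm_num)]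
    norm_num
  obtain ⟨θ, hθ⟩ := harr.2 (singleFam dims κ γ)
  obtain ⟨v, hv⟩ := harr.2 (singleFam dims κ δ)
  have hnorm : ‖v‖ = 1 := by
    have hsq : ⟪v, v⟫ = 1 := by
      rw [hinner, hv, sum_singleFam_mul_self hκ, Finset.sum_range_succ, Finset.sum_range_succ',
        Finset.sum_eq_zero]
      · simp only [hδ, sq]
        simp only [true_or, or_true, if_true, hsqrt]
        norm_num
      · intro i hi
        have := Finset.mem_range.1 hi
        simp [hδ, show i ≠ m + 1 by omega]
    rw [real_inner_self_eq_norm_sq] at hsq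
    exact (pow_eq_one_iff_of_nonneg (norm_nonneg v) two_ne_zero).1 hsq
  have hprod : ∀ t : ℝ, ∏ i ∈ Finset.range (m + 3), (γ + t • δ) i = a / 2 * t ^ 2 := by
    intro t
    rw [Finset.prod_range_succ, Finset.prod_range_succ', Finset.prod_range_succ',
      Finset.prod_eq_one]
    · simp [hγ, hδ]
      linear_combination a * t ^ 2 * hsqrt
    · intro i hi
      have := Finset.mem_range.1 hi
      simp [hγ, hδ, show i ≠ m by omega]
  have hline : ∀ t : ℝ, linLoss dims loss x y arr (θ + t • v) =
      φ ((a / 2 * t ^ 2) • EuclideanSpace.single (p, q) (1 : ℝ)) := by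
    intro t
    rw [linLoss, map_add, map_smul, hθ, hv, singleFam_add_smul]
    congr 1
    ext ⟨i, j⟩
    change segProd _ _ 0 (m + 2 + 1) i j = _
    rw [segProd_singleFam hκ _ (by omega), hprod]
    simp [hκdef, Fin.ext_iff]
  refine ⟨θ, v, hnorm, ?_⟩
  rw [hessQ_of_quadratic_line (contDiff_linLoss dims hsm x y arr)
    (contDiff_phiE (m + 3) dims hsm x y) hline]
  rw [EuclideanSpace.inner_single_right]
  simp only [conj_trivial, one_mul]
  rw [ha, div_mul_cancel₀ _ hpq]
  linarith
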